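/- For p = 2, for all but an o(1)-proportion of partitions μ of n, the reduced partition μ̃ (obtained by merging equal pairs of parts repeatedly until no part repeats 2 or more times, i.e., all parts distinct) has a part of size at least (1 + 1/100)·(√6/(2π))·√n·log n. -/

import Mathlib

open Real Filter

/-- One merging step for `p = 2`: replace two equal parts `m > 0` by one part `2m`. -/
def MergeStep (p : ℕ) (s t : Multiset ℕ) : Prop :=
  ∃ m : ℕ, 0 < m ∧ Multiset.replicate p m ≤ s ∧
    t = (s - Multiset.replicate p m) + {p * m}

/-- No part occurs `p` or more times; for `p = 2` this means all parts are distinct. -/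
def Reduced (p : ℕ) (s : Multiset ℕ) : Prop := ∀ m : ℕ, s.count m ≤ p - 1

section
open MeasureTheory ProbabilityTheory

/-- The Boltzmann measure: independent geometric multiplicities. -/
noncomputable def BM (q : unitInterval) : Measure (ℕ → ℕ) :=
  Measure.infinitePi (fun k : ℕ => geometricMeasure (unitInterval.symm (q ^ k)))

instance (q : unitInterval) : IsProbabilityMeasure (BM q) := by
  unfold BM; infer_instance

/-- An event that depends only on the coordinates in `S`. -/
def DepOn (S : Finset ℕ) (A : Set (ℕ → ℕ)) : Prop :=
  ∀ w w' : ℕ → ℕ, (∀ k ∈ S, w k = w' k) → w ∈ A → w' ∈ A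

lemma DepOn.eq_preimage {S : Finset ℕ} {A : Set (ℕ → ℕ)} (h : DepOn S A) :
    A = (fun (w : ℕ → ℕ) (i : S) => w i) ⁻¹' ((fun (w : ℕ → ℕ) (i : S) => w i) '' A) := by
  ext w
  constructor
  · intro hw; exact ⟨w, hw, rfl⟩
  · rintro ⟨w', hw', he⟩
    exact h w' w (fun k hk => congrFun he ⟨k, hk⟩) hw'

lemma DepOn.meas {S : Finset ℕ} {A : Set (ℕ → ℕ)} (h : DepOn S A) : MeasurableSet A := by
  rw [h.eq_preimage]
  apply measurableSet_preimage
  · fun_prop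
  · exact MeasurableSet.of_discrete

lemma DepOn.indep {S T : Finset ℕ} {A B : Set (ℕ → ℕ)} (q : unitInterval)
    (hA : DepOn S A) (hB : DepOn T B) (hd : Disjoint S T) :
    (BM q).real (A ∩ B) = (BM q).real A * (BM q).real B := by
  have hi : iIndepFun (fun (k : ℕ) (w : ℕ → ℕ) => w k) (BM q) :=
    iIndepFun_infinitePi (X := fun _ => id) (fun _ => measurable_id)
  have h2 := hi.indepFun_finset S T hd (fun i => measurable_pi_apply i)
  have h3 := h2.measure_inter_preimage_eq_mul
    ((fun (w : ℕ → ℕ) (i : S) => w i) '' A) ((fun (w : ℕ → ℕ) (i : T) => w i) '' B)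
    MeasurableSet.of_discrete MeasurableSet.of_discrete
  rw [← hA.eq_preimage, ← hB.eq_preimage] at h3
  simp [Measure.real, h3]

lemma BM_pi (q : unitInterval) (S : Finset ℕ) (t : ℕ → Set ℕ) :
    (BM q).real {w | ∀ k ∈ S, w k ∈ t k} =
      ∏ k ∈ S, (geometricMeasure (unitInterval.symm (q ^ k))).real (t k) := by
  have := Measure.infinitePi_pi (fun k : ℕ => geometricMeasure (unitInterval.symm (q ^ k)))
    (s := S) (t := t) (fun i _ => MeasurableSet.of_discrete)
  have h2 : {w : ℕ → ℕ | ∀ k ∈ S, w k ∈ t k} = Set.pi (S : Set ℕ) t := by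
    ext w; simp
  rw [h2, BM, Measure.real, this, ENNReal.toReal_prod]
  rfl

lemma geo_ne {q : unitInterval} (h1 : (q : ℝ) < 1) {k : ℕ} (hk : 0 < k) :
    unitInterval.symm (q ^ k) ≠ 0 := by
  intro h
  have := congrArg Subtype.val h
  simp at this
  have h3 := pow_lt_one₀ q.2.1 h1 hk.ne'
  linarith

lemma geo_sing {q : unitInterval} (h1 : (q : ℝ) < 1) {k : ℕ} (hk : 0 < k) (a : ℕ) :
    (geometricMeasure (unitInterval.symm (q ^ k))).real {a} =
      (1 - (q : ℝ) ^ k) * (q : ℝ) ^ (k * a) := by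
  rw [geometricMeasure_real_singleton (geo_ne h1 hk)]
  simp [pow_mul]; ring

lemma BM_cyl {q : unitInterval} (h1 : (q : ℝ) < 1) (S : Finset ℕ) (hS : ∀ k ∈ S, 0 < k)
    (c : ℕ → ℕ) :
    (BM q).real {w | ∀ k ∈ S, w k = c k} =
      ∏ k ∈ S, ((1 - (q : ℝ) ^ k) * (q : ℝ) ^ (k * c k)) := by
  have := BM_pi q S (fun k => {c k})
  simp only [Set.mem_singleton_iff] at this
  rw [this]
  exact Finset.prod_congr rfl fun k hk => geo_sing h1 (hS k hk) _

lemma BM_sing {q : unitInterval} (h1 : (q : ℝ) < 1) {k : ℕ} (hk : 0 < k) (a : ℕ) :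
    (BM q).real {w | w k = a} = (1 - (q : ℝ) ^ k) * (q : ℝ) ^ (k * a) := by
  have := BM_cyl h1 {k} (by simpa using hk) (fun _ => a)
  simpa using this

lemma depOn_single (k : ℕ) (p : ℕ → Prop) : DepOn {k} {w | p (w k)} := by
  intro w w' h hw
  have := h k (by simp)
  simpa [← this] using hw

lemma BM_tail {q : unitInterval} (h1 : (q : ℝ) < 1) {k : ℕ} (hk : 0 < k) (a : ℕ) :
    (BM q).real {w | a ≤ w k} = (q : ℝ) ^ (k * a) := by
  induction a with
  | zero => simp
  | succ a ih =>
    have h2 : {w : ℕ → ℕ | a ≤ w k} = {w | a + 1 ≤ w k} ∪ {w | w k = a} := by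
      ext w; simp; omega
    have h3 : Disjoint {w : ℕ → ℕ | a + 1 ≤ w k} {w | w k = a} := by
      rw [Set.disjoint_left]; intro w; simp; omega
    rw [h2, measureReal_union h3 (depOn_single k (fun x => x = a)).meas, BM_sing h1 hk] at ih
    have : (q : ℝ) ^ (k * (a + 1)) = q ^ k * q ^ (k * a) := by ring
    rw [this]; linarith

/-- Swapping coordinates between two independent copies preserves the law. -/
lemma BM_swap (q : unitInterval) (t : ℕ) :
    ((BM q).prod (BM q)).map
      (fun (z : (ℕ → ℕ) × (ℕ → ℕ)) (k : ℕ) => if k ≤ t then z.1 k else z.2 k) = BM q := by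
  apply Measure.eq_infinitePi
  intro s A hA
  rw [Measure.map_apply _ (MeasurableSet.pi s.countable_toSet fun i _ => hA i)]
  · have : (fun (z : (ℕ → ℕ) × (ℕ → ℕ)) (k : ℕ) => if k ≤ t then z.1 k else z.2 k) ⁻¹'
        (Set.pi s A) = (Set.pi s (fun k => if k ≤ t then A k else Set.univ)) ×ˢ
        (Set.pi s (fun k => if k ≤ t then Set.univ else A k)) := by
      ext z
      simp only [Set.mem_preimage, Set.mem_pi, Set.mem_prod]
      constructor
      · intro h
        refine ⟨fun k hk => ?_, fun k hk => ?_⟩ <;> have := h k hk <;> split_ifs with hh <;>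
          simp_all
      · rintro ⟨h, h'⟩ k hk
        have a := h k hk
        have b := h' k hk
        split_ifs with hh <;> simp_all
    rw [this, Measure.prod_prod, BM, Measure.infinitePi_pi, Measure.infinitePi_pi,
      ← Finset.prod_mul_distrib]
    · refine Finset.prod_congr rfl fun k _ => ?_
      split_ifs <;> simp
    · intro i _; exact MeasurableSet.of_discrete
    · intro i _; exact MeasurableSet.of_discrete
  · refine measurable_pi_lambda _ fun k => ?_
    split_ifs <;> fun_prop


/-- total size -/
def NN (n : ℕ) (w : ℕ → ℕ) : ℕ := ∑ j ∈ Finset.Icc 1 n, j * w j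

/-- normalising product -/
noncomputable def WW (n : ℕ) (q : ℝ) : ℝ := ∏ k ∈ Finset.Icc 1 n, (1 - q ^ k)

/-- cylinder of a partition -/
def Cyl (n : ℕ) {k : ℕ} (μ : Nat.Partition k) : Set (ℕ → ℕ) :=
  {w | ∀ j ∈ Finset.Icc 1 n, w j = μ.parts.count j}

lemma sum_count_eq (n : ℕ) (s : Multiset ℕ) (hs : ∀ i ∈ s, 0 < i ∧ i ≤ n) :
    ∑ j ∈ Finset.Icc 1 n, j * s.count j = s.sum := by
  rw [Finset.sum_multiset_count_of_subset s (Finset.Icc 1 n)]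
  · exact Finset.sum_congr rfl fun j _ => by simp [mul_comm]
  · intro i hi
    have := hs i (by simpa using hi)
    simp; omega

lemma parts_bd {n k : ℕ} (hk : k ≤ n) (μ : Nat.Partition k) :
    ∀ i ∈ μ.parts, 0 < i ∧ i ≤ n := fun i hi =>
  ⟨μ.parts_pos hi, (Nat.Partition.le_of_mem_parts hi).trans hk⟩

lemma Cyl_dep (n : ℕ) {k : ℕ} (μ : Nat.Partition k) : DepOn (Finset.Icc 1 n) (Cyl n μ) := by
  intro w w' h hw j hj
  rw [← h j hj]; exact hw j hj

lemma NN_dep (n : ℕ) (p : ℕ → Prop) : DepOn (Finset.Icc 1 n) {w | p (NN n w)} := by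
  intro w w' h hw
  have : NN n w = NN n w' := Finset.sum_congr rfl fun j hj => by rw [h j hj]
  simpa [← this] using hw

lemma Cyl_meas {n k : ℕ} (hk : k ≤ n) {q : unitInterval} (h1 : (q : ℝ) < 1)
    (μ : Nat.Partition k) : (BM q).real (Cyl n μ) = (q : ℝ) ^ k * WW n q := by
  rw [Cyl, BM_cyl h1 _ (by simp; omega), Finset.prod_mul_distrib, Finset.prod_pow_eq_pow_sum,
    sum_count_eq n _ (parts_bd hk μ), μ.parts_sum, WW, mul_comm]

lemma Cyl_disj {n k : ℕ} (hk : k ≤ n) (μ ν : Nat.Partition k) (h : μ ≠ ν) :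
    Disjoint (Cyl n μ) (Cyl n ν) := by
  rw [Set.disjoint_left]
  intro w hw hw'
  apply h
  ext j
  by_cases hj : j ∈ Finset.Icc 1 n
  · rw [← hw j hj, ← hw' j hj]
  · rw [Multiset.count_eq_zero_of_notMem, Multiset.count_eq_zero_of_notMem]
    · intro h; apply hj; have := parts_bd hk ν j h; simp; omega
    · intro h; apply hj; have := parts_bd hk μ j h; simp; omega

lemma Cyl_count {n k : ℕ} (hk : k ≤ n) {q : unitInterval} (h1 : (q : ℝ) < 1)
    (B : Finset (Nat.Partition k)) :
    (BM q).real (⋃ μ ∈ B, Cyl n μ) = (B.card : ℝ) * ((q : ℝ) ^ k * WW n q) := by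
  rw [measureReal_biUnion_finset]
  · rw [Finset.sum_congr rfl fun μ _ => Cyl_meas hk h1 μ]; simp
  · intro μ _ ν _ h; exact Cyl_disj hk μ ν h
  · intro μ _; exact (Cyl_dep n μ).meas

lemma NN_eq {n k : ℕ} (hk : k ≤ n) :
    {w | NN n w = k} = ⋃ μ ∈ (Finset.univ : Finset (Nat.Partition k)), Cyl n μ := by
  ext w
  simp only [Set.mem_ofPred_eq, Finset.mem_univ, Set.iUnion_true, Set.mem_iUnion]
  constructor
  · intro h
    let s : Multiset ℕ := ∑ j ∈ Finset.Icc 1 n, Multiset.replicate (w j) j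
    have hs : ∀ i ∈ s, 0 < i := by
      intro i hi
      obtain ⟨j, hj, hj'⟩ := Multiset.mem_sum.1 hi
      have := Multiset.eq_of_mem_replicate hj'
      simp at hj; omega
    refine ⟨⟨s, fun {i} hi => hs i hi, ?_⟩, ?_⟩
    · rw [← h, NN, Multiset.sum_sum]
      exact Finset.sum_congr rfl fun j _ => by simp [mul_comm]
    · intro j hj
      simp only [s, Multiset.count_sum', Multiset.count_replicate]
      rw [Finset.sum_ite_eq' ]
      simp only [hj, if_true]
  · rintro ⟨μ, hμ⟩
    rw [NN, Finset.sum_congr rfl fun j hj => by rw [hμ j hj], sum_count_eq n _ (parts_bd hk μ),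
      μ.parts_sum]

lemma NN_prob {n k : ℕ} (hk : k ≤ n) {q : unitInterval} (h1 : (q : ℝ) < 1) :
    (BM q).real {w | NN n w = k} =
      (Fintype.card (Nat.Partition k) : ℝ) * ((q : ℝ) ^ k * WW n q) := by
  rw [NN_eq hk, Cyl_count hk h1]; rfl

lemma part_mono {k n : ℕ} (h : k ≤ n) :
    Fintype.card (Nat.Partition k) ≤ Fintype.card (Nat.Partition n) := by
  refine Fintype.card_le_of_injective
    (fun μ : Nat.Partition k => (⟨μ.parts + Multiset.replicate (n - k) 1, ?_, ?_⟩ :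
      Nat.Partition n)) ?_
  · intro i hi
    rcases Multiset.mem_add.1 hi with h | h
    · exact μ.parts_pos h
    · rw [Multiset.eq_of_mem_replicate h]; exact one_pos
  · simp [μ.parts_sum]; omega
  · intro μ ν h
    simp at h
    exact Nat.Partition.ext h

lemma NN_window {n : ℕ} {q : unitInterval} (h1 : (q : ℝ) < 1) (a : ℕ) :
    (BM q).real {w | a ≤ NN n w ∧ NN n w ≤ n} =
      ∑ k ∈ Finset.Icc a n, (Fintype.card (Nat.Partition k) : ℝ) * ((q : ℝ) ^ k * WW n q) := by
  have : {w | a ≤ NN n w ∧ NN n w ≤ n} = ⋃ k ∈ Finset.Icc a n, {w | NN n w = k} := by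
    ext w; simp
  rw [this, measureReal_biUnion_finset]
  · exact Finset.sum_congr rfl fun k hk => NN_prob (by simp at hk; omega) h1
  · intro i _ j _ hij
    simp only [Function.onFun]
    rw [Set.disjoint_left]; intro w; simp; omega
  · intro k _; exact (NN_dep n (fun x => x = k)).meas

/-- The polynomial giving the probability that the size is at most `n`. -/
noncomputable def QQ (n : ℕ) (q : ℝ) : ℝ :=
  ∑ k ∈ Finset.Icc 0 n, (Fintype.card (Nat.Partition k) : ℝ) * (q ^ k * WW n q)

lemma NN_le_prob {n : ℕ} {q : unitInterval} (h1 : (q : ℝ) < 1) :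
    (BM q).real {w | NN n w ≤ n} = QQ n q := by
  have := NN_window (n := n) h1 0
  simpa [QQ] using this

lemma exists_q {n : ℕ} (hn : 0 < n) {θ : ℝ} (h0 : 0 < θ) (h1 : θ < 1) :
    ∃ q : unitInterval, 0 < (q : ℝ) ∧ (q : ℝ) < 1 ∧ QQ n q = θ := by
  have hc : ContinuousOn (QQ n) (Set.Icc 0 1) := by
    apply Continuous.continuousOn
    unfold QQ WW
    fun_prop
  have e0 : QQ n 0 = 1 := by
    unfold QQ
    rw [Finset.sum_eq_single 0]
    · simp only [WW, pow_zero, one_mul]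
      rw [Finset.prod_eq_one]
      · simp [Nat.card_unique]
      · intro k hk; simp at hk; simp; omega
    · intro k _ hk; simp [hk]
    · simp
  have e1 : QQ n 1 = 0 := by
    unfold QQ
    refine Finset.sum_eq_zero fun k _ => ?_
    have : WW n 1 = 0 := Finset.prod_eq_zero (i := 1) (by simp; omega) (by simp)
    simp [this]
  have := intermediate_value_Icc' (zero_le_one) hc
  rw [e0, e1] at this
  obtain ⟨q, hq, hq'⟩ := this ⟨h0.le, h1.le⟩
  refine ⟨⟨q, hq⟩, ?_, ?_, hq'⟩
  · rcases hq.1.lt_or_eq with h | h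
    · exact h
    · subst h; linarith
  · rcases hq.2.lt_or_eq with h | h
    · exact h
    · subst h; linarith


lemma coord_mp (q : unitInterval) (k : ℕ) :
    MeasurePreserving (Function.eval k) (BM q) (geometricMeasure (unitInterval.symm (q ^ k))) :=
  measurePreserving_eval_infinitePi _ k

lemma coord_integrable {q : unitInterval} (h1 : (q : ℝ) < 1) {k : ℕ} (hk : 0 < k) :
    Integrable (fun w : ℕ → ℕ => (w k : ℝ)) (BM q) := by
  have h := (integrable_geometricMeasure_iff (f := fun a : ℕ => (a : ℝ)) (geo_ne h1 hk)).2 (by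
    simp only [unitInterval.coe_symm_eq, sub_sub_cancel, Real.norm_natCast]
    have hx := pow_lt_one₀ q.2.1 h1 hk.ne'
    have := (hasSum_coe_mul_geometric_of_norm_lt_one (𝕜 := ℝ) (r := (q : ℝ) ^ k) (by
      rw [Real.norm_of_nonneg (pow_nonneg q.2.1 _)]; exact hx)).summable.mul_left (1 - (q : ℝ) ^ k)
    refine this.congr fun a => ?_
    push_cast; ring)
  exact (coord_mp q k).integrable_comp_of_integrable h

lemma coord_integral {q : unitInterval} (h1 : (q : ℝ) < 1) {k : ℕ} (hk : 0 < k) :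
    ∫ w, ((w k : ℕ) : ℝ) ∂(BM q) = (q : ℝ) ^ k / (1 - (q : ℝ) ^ k) := by
  have hx := pow_lt_one₀ q.2.1 h1 hk.ne'
  have h : ∫ w, ((Function.eval k w : ℕ) : ℝ) ∂(BM q) = ∫ a, (a : ℝ) ∂(geometricMeasure (unitInterval.symm (q ^ k))) := by
    rw [← (coord_mp q k).map_eq, integral_map (coord_mp q k).measurable.aemeasurable]
    exact (measurable_of_countable _).aestronglyMeasurable
  simp only [Function.eval] at h
  rw [h, integral_geometricMeasure (geo_ne h1 hk)]
  simp only [unitInterval.coe_symm_eq, sub_sub_cancel, smul_eq_mul]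
  have := (hasSum_coe_mul_geometric_of_norm_lt_one (𝕜 := ℝ) (r := (q : ℝ) ^ k) (by
      rw [Real.norm_of_nonneg (pow_nonneg q.2.1 _)]; exact hx)).mul_left (1 - (q : ℝ) ^ k)
  have h2 := this.tsum_eq
  calc _ = ∑' b : ℕ, (1 - (q : ℝ) ^ k) * ((b : ℝ) * ((q : ℝ) ^ k) ^ b) := by
        refine tsum_congr fun b => ?_
        push_cast; ring
    _ = _ := by
        rw [h2]
        have : (1 - (q : ℝ) ^ k) ≠ 0 := by linarith
        field_simp

lemma term_bd {u : ℝ} (hu : 0 < u) {j : ℕ} (hj : 0 < j) :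
    (j : ℝ) * (Real.exp (-u) ^ j / (1 - Real.exp (-u) ^ j)) ≤ (1 / u) * Real.exp (-u / 2) ^ j := by
  rw [← Real.exp_nat_mul, ← Real.exp_nat_mul]
  set x : ℝ := j * u with hx
  have hj' : (0 : ℝ) < j := by exact_mod_cast hj
  have hxp : 0 < x := by positivity
  have e1 : (j : ℝ) * -u = -x := by rw [hx]; ring
  have e2 : (j : ℝ) * (-u / 2) = -(x / 2) := by rw [hx]; ring
  rw [e1, e2]
  have hs : x / 2 ≤ Real.sinh (x / 2) := Real.self_le_sinh_iff.2 (by positivity)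
  rw [Real.sinh_eq] at hs
  have hE : Real.exp (-x) = Real.exp (-(x / 2)) * Real.exp (-(x / 2)) := by
    rw [← Real.exp_add]; ring_nf
  have hE1 : Real.exp (x / 2) * Real.exp (-(x / 2)) = 1 := by
    rw [← Real.exp_add]; simp
  have hlt : Real.exp (-x) < 1 := by rw [Real.exp_lt_one_iff]; linarith
  have hpos := Real.exp_pos (-(x / 2))
  have hden : 0 < 1 - Real.exp (-x) := by linarith
  rw [show (1 / u) = j / x by rw [hx]; field_simp, mul_comm_div]
  apply mul_le_mul_of_nonneg_left _ hj'.le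
  rw [div_le_div_iff₀ hden hxp]
  nlinarith [mul_le_mul_of_nonneg_left hs hpos.le]

lemma mean_bd {u : ℝ} (hu : 0 < u) (n : ℕ) :
    ∑ j ∈ Finset.Icc 1 n, (j : ℝ) * (Real.exp (-u) ^ j / (1 - Real.exp (-u) ^ j)) ≤ 2 / u ^ 2 := by
  have hs1 : Real.exp (-u / 2) < 1 := by rw [Real.exp_lt_one_iff]; linarith
  have hs0 := Real.exp_pos (-u / 2)
  calc _ ≤ ∑ j ∈ Finset.Icc 1 n, (1 / u) * Real.exp (-u / 2) ^ j :=
        Finset.sum_le_sum fun j hj => term_bd hu (by simp at hj; omega)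
    _ = (1 / u) * ∑ j ∈ Finset.Icc 1 n, Real.exp (-u / 2) ^ j := by rw [Finset.mul_sum]
    _ ≤ (1 / u) * (2 / u) := by
        apply mul_le_mul_of_nonneg_left _ (by positivity)
        have h1 : ∑ j ∈ Finset.Icc 1 n, Real.exp (-u / 2) ^ j =
            Real.exp (-u / 2) * ∑ j ∈ Finset.range n, Real.exp (-u / 2) ^ j := by
          rw [Finset.mul_sum, Finset.range_eq_Ico, ← Finset.Ico_add_one_right_eq_Icc,
            Finset.sum_Ico_add' (fun j => Real.exp (-u / 2) ^ j) 0 n 1 |>.symm]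
          exact Finset.sum_congr rfl fun j _ => by ring
        have h2 : ∑ j ∈ Finset.range n, Real.exp (-u / 2) ^ j ≤ (1 - Real.exp (-u / 2))⁻¹ := by
          rw [← tsum_geometric_of_lt_one hs0.le hs1]
          exact (summable_geometric_of_lt_one hs0.le hs1).sum_le_tsum _ (fun _ _ => by positivity)
        rw [h1]
        refine (mul_le_mul_of_nonneg_left h2 hs0.le).trans ?_
        rw [← div_eq_mul_inv, div_le_div_iff₀ (by linarith) hu]
        have h3 := Real.add_one_le_exp (u / 2)
        have h4 : Real.exp (u / 2) * Real.exp (-u / 2) = 1 := by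
          rw [← Real.exp_add]; ring_nf; simp
        nlinarith
    _ = 2 / u ^ 2 := by field_simp

lemma markov {n : ℕ} {q : unitInterval} {u : ℝ} (hu : 0 < u)
    (hq : (q : ℝ) = Real.exp (-u)) : (n : ℝ) * (1 - QQ n q) ≤ 2 / u ^ 2 := by
  have h1 : (q : ℝ) < 1 := by rw [hq, Real.exp_lt_one_iff]; linarith
  have hint : Integrable (fun w => (NN n w : ℝ)) (BM q) := by
    simp only [NN]; push_cast
    exact integrable_finsetSum _ fun j hj =>
      (coord_integrable h1 (by simp at hj; omega)).const_mul _
  have hI : ∫ w, (NN n w : ℝ) ∂(BM q) ≤ 2 / u ^ 2 := by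
    simp only [NN]; push_cast
    rw [integral_finsetSum _ fun j hj =>
      (coord_integrable h1 (by simp at hj; omega)).const_mul _]
    refine le_trans (le_of_eq ?_) (mean_bd hu n)
    refine Finset.sum_congr rfl fun j hj => ?_
    rw [integral_const_mul, coord_integral h1 (by simp at hj; omega), hq]
  have hM := mul_meas_ge_le_integral_of_nonneg (μ := BM q) (f := fun w => (NN n w : ℝ))
    (Filter.Eventually.of_forall fun w => by positivity) hint n
  refine le_trans ?_ (hM.trans hI)
  apply mul_le_mul_of_nonneg_left _ (by positivity)
  rw [← NN_le_prob h1, ← probReal_compl_eq_one_sub (NN_dep n (fun x => x ≤ n)).meas]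
  refine measureReal_mono ?_ (measure_ne_top _ _)
  intro w hw
  simp at hw ⊢
  omega

lemma lower_u {n K : ℕ} (hK : K ≤ n) {q : unitInterval} {u : ℝ} (hu : 0 < u)
    (hq : (q : ℝ) = Real.exp (-u)) (huK : u * K ≤ 1) :
    QQ n q * (13 / 10) ^ K ≤ Real.exp (u * n) := by
  have h1 : (q : ℝ) < 1 := by rw [hq, Real.exp_lt_one_iff]; linarith
  have h0 : (0 : ℝ) < q := by rw [hq]; exact Real.exp_pos _
  have hW : WW n ((q : ℝ) ^ 2) = WW n q * ∏ k ∈ Finset.Icc 1 n, (1 + (q : ℝ) ^ k) := by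
    simp only [WW]
    rw [← Finset.prod_mul_distrib]
    exact Finset.prod_congr rfl fun k _ => by rw [← pow_mul]; ring
  have hW0 : 0 ≤ WW n q := Finset.prod_nonneg fun k _ => by
    have := pow_le_one₀ (n := k) h0.le h1.le; linarith
  have hP : (13 / 10 : ℝ) ^ K ≤ ∏ k ∈ Finset.Icc 1 n, (1 + (q : ℝ) ^ k) := by
    calc (13 / 10 : ℝ) ^ K = ∏ k ∈ Finset.Icc 1 K, (13 / 10 : ℝ) := by rw [Finset.prod_const]; simp
      _ ≤ ∏ k ∈ Finset.Icc 1 K, (1 + (q : ℝ) ^ k) := by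
          refine Finset.prod_le_prod (fun _ _ => by norm_num) fun k hk => ?_
          simp at hk
          have : Real.exp (-1) ≤ (q : ℝ) ^ k := by
            rw [hq, ← Real.exp_nat_mul, Real.exp_le_exp]
            have : (k : ℝ) ≤ K := by exact_mod_cast hk.2
            nlinarith
          have := Real.exp_neg_one_gt_d9
          linarith
      _ ≤ _ := by
          refine Finset.prod_le_prod_of_subset_of_one_le (Finset.Icc_subset_Icc_right hK)
            (fun _ _ => by positivity) fun k _ _ => ?_
          have : 0 < (q : ℝ) ^ k := by positivity
          linarith
  have h2 : QQ n ((q : ℝ) ^ 2) ≤ 1 := by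
    have : ((q ^ 2 : unitInterval) : ℝ) = (q : ℝ) ^ 2 := by simp
    rw [← this, ← NN_le_prob]
    · exact measureReal_le_one
    · rw [this]; exact pow_lt_one₀ h0.le h1 (by norm_num)
  have h3 : QQ n q * (q : ℝ) ^ n * (∏ k ∈ Finset.Icc 1 n, (1 + (q : ℝ) ^ k)) ≤
      QQ n ((q : ℝ) ^ 2) := by
    unfold QQ
    rw [Finset.sum_mul, Finset.sum_mul]
    refine Finset.sum_le_sum fun k hk => ?_
    rw [hW]
    simp at hk
    have hk2 : (q : ℝ) ^ n ≤ q ^ k := pow_le_pow_of_le_one h0.le h1.le hk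
    have hPp : 0 ≤ ∏ k ∈ Finset.Icc 1 n, (1 + (q : ℝ) ^ k) :=
      Finset.prod_nonneg fun _ _ => by positivity
    have : ((q : ℝ) ^ 2) ^ k = q ^ k * q ^ k := by ring
    rw [this]
    have h5 : 0 ≤ (Fintype.card (Nat.Partition k) : ℝ) * ((q : ℝ) ^ k * WW n q) *
        ∏ k ∈ Finset.Icc 1 n, (1 + (q : ℝ) ^ k) := by positivity
    calc _ = ((Fintype.card (Nat.Partition k) : ℝ) * ((q : ℝ) ^ k * WW n q) *
        ∏ k ∈ Finset.Icc 1 n, (1 + (q : ℝ) ^ k)) * (q : ℝ) ^ n := by ring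
      _ ≤ ((Fintype.card (Nat.Partition k) : ℝ) * ((q : ℝ) ^ k * WW n q) *
        ∏ k ∈ Finset.Icc 1 n, (1 + (q : ℝ) ^ k)) * (q : ℝ) ^ k := by gcongr
      _ = _ := by ring
  have hQ0 : 0 ≤ QQ n q := by rw [← NN_le_prob h1]; exact measureReal_nonneg
  have hqn : (q : ℝ) ^ n * Real.exp (u * n) = 1 := by
    rw [hq, ← Real.exp_nat_mul, ← Real.exp_add]; ring_nf; simp
  have h6 : QQ n q * (q : ℝ) ^ n * (13 / 10) ^ K ≤ 1 :=
    le_trans (mul_le_mul_of_nonneg_left hP (by positivity)) (h3.trans h2)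
  calc QQ n q * (13 / 10) ^ K = QQ n q * (13 / 10) ^ K * ((q : ℝ) ^ n * Real.exp (u * n)) := by
        rw [hqn]; ring
    _ = (QQ n q * (q : ℝ) ^ n * (13 / 10) ^ K) * Real.exp (u * n) := by ring
    _ ≤ 1 * Real.exp (u * n) := by gcongr
    _ = _ := one_mul _

lemma max_bd {n g : ℕ} {q : unitInterval} (h1 : (q : ℝ) < 1) :
    (BM q).real {w | ∃ j ∈ Finset.Icc 1 n, g < j * w j} ≤ n * (q : ℝ) ^ g := by
  have : {w : ℕ → ℕ | ∃ j ∈ Finset.Icc 1 n, g < j * w j} =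
      ⋃ j ∈ Finset.Icc 1 n, {w | g < j * w j} := by ext w; simp
  rw [this]
  refine (measureReal_biUnion_finset_le _ _).trans ?_
  calc _ ≤ ∑ j ∈ Finset.Icc 1 n, (q : ℝ) ^ g := by
        refine Finset.sum_le_sum fun j hj => ?_
        simp at hj
        have e : {w : ℕ → ℕ | g < j * w j} = {w | g / j + 1 ≤ w j} := by
          ext w
          simp only [Set.mem_ofPred_eq]
          rw [Nat.succ_le_iff, Nat.div_lt_iff_lt_mul (by omega), mul_comm]
        rw [e, BM_tail h1 (by omega)]
        exact pow_le_pow_of_le_one q.2.1 h1.le (Nat.lt_mul_div_succ g (by omega)).le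
    _ = _ := by simp

lemma crossing {n g : ℕ} (w w' : ℕ → ℕ) (hw : NN n w ≤ n) (hw' : n < NN n w')
    (hg : ∀ j ∈ Finset.Icc 1 n, j * w' j ≤ g) :
    ∃ t ∈ Finset.range (n + 1),
      n - g ≤ NN n (fun k => if k ≤ t then w k else w' k) ∧
        NN n (fun k => if k ≤ t then w k else w' k) ≤ n := by
  classical
  have hex : ∃ t, NN n (fun k => if k ≤ t then w k else w' k) ≤ n := ⟨n, by
    convert hw using 1
    refine Finset.sum_congr rfl fun k hk => ?_
    simp at hk; simp [hk.2]⟩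
  have hn : Nat.find hex ≤ n := Nat.find_min' hex (by
    convert hw using 1
    refine Finset.sum_congr rfl fun k hk => ?_
    simp at hk; simp [hk.2])
  refine ⟨Nat.find hex, Finset.mem_range.2 (by omega), ?_, Nat.find_spec hex⟩
  rcases Nat.eq_zero_or_pos (Nat.find hex) with h | h
  · exfalso
    have := Nat.find_spec hex
    rw [h] at this
    have e : NN n (fun k => if k ≤ 0 then w k else w' k) = NN n w' := by
      refine Finset.sum_congr rfl fun k hk => ?_
      simp at hk; simp only [if_neg (show ¬ k ≤ 0 by omega)]
    omega
  · obtain ⟨t, ht⟩ : ∃ t, Nat.find hex = t + 1 := ⟨Nat.find hex - 1, by omega⟩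
    have hm := Nat.find_min hex (m := t) (by omega)
    rw [ht]
    have htn : t + 1 ∈ Finset.Icc 1 n := by simp; omega
    have hgt := hg _ htn
    have : NN n (fun k => if k ≤ t then w k else w' k) ≤
        NN n (fun k => if k ≤ t + 1 then w k else w' k) + (t + 1) * w' (t + 1) := by
      unfold NN
      rw [← Finset.add_sum_erase _ _ htn, ← Finset.add_sum_erase _ (fun k => k * if k ≤ t + 1 then w k else w' k) htn]
      have e : ∑ x ∈ (Finset.Icc 1 n).erase (t + 1), x * (if x ≤ t then w x else w' x) =
          ∑ x ∈ (Finset.Icc 1 n).erase (t + 1), x * (if x ≤ t + 1 then w x else w' x) := by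
        refine Finset.sum_congr rfl fun k hk => ?_
        have := Finset.ne_of_mem_erase hk
        by_cases h : k ≤ t
        · rw [if_pos h, if_pos (by omega)]
        · rw [if_neg h, if_neg (by omega)]
      rw [e]
      simp
      omega
    omega

lemma window_lb {n g : ℕ} {q : unitInterval} (h1 : (q : ℝ) < 1) :
    QQ n q * (1 - QQ n q - n * (q : ℝ) ^ g) ≤
      (n + 1) * (BM q).real {w | n - g ≤ NN n w ∧ NN n w ≤ n} := by
  set A : Set (ℕ → ℕ) := {w | NN n w ≤ n}
  set M : Set (ℕ → ℕ) := {w | ∃ j ∈ Finset.Icc 1 n, g < j * w j}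
  have hAm : MeasurableSet A := (NN_dep n (fun x => x ≤ n)).meas
  set V : Set (ℕ → ℕ) := {w | n - g ≤ NN n w ∧ NN n w ≤ n}
  have hV : MeasurableSet V := (NN_dep n (fun x => n - g ≤ x ∧ x ≤ n)).meas
  have hB : 1 - QQ n q - n * (q : ℝ) ^ g ≤ (BM q).real (Aᶜ \ M) := by
    have := le_measureReal_sdiff (μ := BM q) (s₁ := Aᶜ) (s₂ := M)
    rw [probReal_compl_eq_one_sub hAm, NN_le_prob h1] at this
    have h2 := max_bd (n := n) (g := g) h1
    linarith
  have hsub : A ×ˢ (Aᶜ \ M) ⊆ ⋃ t ∈ Finset.range (n + 1),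
      (fun (z : (ℕ → ℕ) × (ℕ → ℕ)) (k : ℕ) => if k ≤ t then z.1 k else z.2 k) ⁻¹' V := by
    rintro ⟨w, w'⟩ ⟨hw, hw', hM⟩
    simp only [A, M, Set.mem_compl_iff, Set.mem_ofPred_eq, not_le, not_exists, not_and, not_lt] at *
    obtain ⟨t, ht, h⟩ := crossing w w' hw hw' hM
    simp only [Set.mem_iUnion]
    exact ⟨t, ht, h⟩
  have h3 : ((BM q).prod (BM q)).real (A ×ˢ (Aᶜ \ M)) ≤ (n + 1) * (BM q).real V := by
    refine (measureReal_mono hsub (measure_ne_top _ _)).trans ((measureReal_biUnion_finset_le _ _).trans ?_)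
    have : ∀ t ∈ Finset.range (n + 1), ((BM q).prod (BM q)).real
      ((fun (z : (ℕ → ℕ) × (ℕ → ℕ)) (k : ℕ) => if k ≤ t then z.1 k else z.2 k) ⁻¹' V) =
        (BM q).real V := by
      intro t _
      conv_rhs => rw [← BM_swap q t]
      rw [map_measureReal_apply _ hV]
      refine measurable_pi_lambda _ fun k => ?_
      split_ifs <;> fun_prop
    rw [Finset.sum_congr rfl this]
    simp
  rw [measureReal_prod_prod, NN_le_prob h1] at h3
  have hQ0 : 0 ≤ QQ n q := by rw [← NN_le_prob h1]; exact measureReal_nonneg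
  exact (mul_le_mul_of_nonneg_left hB hQ0).trans h3

lemma pn_lb {n g : ℕ} {q : unitInterval} (h1 : (q : ℝ) < 1) :
    (q : ℝ) ^ g * (QQ n q * (1 - QQ n q - n * (q : ℝ) ^ g)) ≤
      (n + 1) * ((n + 1) * ((Fintype.card (Nat.Partition n) : ℝ) * ((q : ℝ) ^ n * WW n q))) := by
  have hq0 : (0 : ℝ) ≤ q := q.2.1
  have hW0 : 0 ≤ WW n q := Finset.prod_nonneg fun k _ => by
    have := pow_le_one₀ (n := k) hq0 h1.le; linarith
  refine (mul_le_mul_of_nonneg_left (window_lb h1) (by positivity)).trans ?_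
  rw [NN_window h1, mul_left_comm]
  apply mul_le_mul_of_nonneg_left _ (by positivity)
  rw [Finset.mul_sum]
  calc _ ≤ ∑ k ∈ Finset.Icc (n - g) n,
        (Fintype.card (Nat.Partition n) : ℝ) * ((q : ℝ) ^ n * WW n q) := by
        refine Finset.sum_le_sum fun k hk => ?_
        simp at hk
        have a : (Fintype.card (Nat.Partition k) : ℝ) ≤ Fintype.card (Nat.Partition n) := by
          exact_mod_cast part_mono hk.2
        have b : (q : ℝ) ^ (g + k) ≤ q ^ n := pow_le_pow_of_le_one hq0 h1.le (by omega)
        calc _ = (Fintype.card (Nat.Partition k) : ℝ) * ((q : ℝ) ^ (g + k) * WW n q) := by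
              rw [pow_add]; ring
          _ ≤ _ := by gcongr
    _ ≤ _ := by
        rw [Finset.sum_const, nsmul_eq_mul]
        apply mul_le_mul_of_nonneg_right _ (by positivity)
        have : (Finset.Icc (n - g) n).card ≤ n + 1 := by simp
        exact_mod_cast this


lemma depOn_sum (S : Finset ℕ) (p : ℕ → Prop) : DepOn S {w | p (∑ k ∈ S, k * w k)} := by
  intro w w' h hw
  have : ∑ k ∈ S, k * w k = ∑ k ∈ S, k * w' k := Finset.sum_congr rfl fun j hj => by rw [h j hj]
  simpa [← this] using hw

lemma class_tail {q : unitInterval} {u : ℝ} (hu : 0 < u) (hq : (q : ℝ) = Real.exp (-u))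
    {k0 : ℕ} (hk0 : 0 < k0) (H : ℕ → ℕ) (J : Finset ℕ) :
    (∀ k ∈ J, 0 < k) → k0 ∉ J → ∀ y : ℝ, ∑ k ∈ J, (k : ℝ) * H k ≤ y →
    Real.exp (-(u * (y + k0))) * ∏ k ∈ J, (((H k : ℝ) + 1) * (1 - (q : ℝ) ^ k)) ≤
      (BM q).real {w | y ≤ ((∑ k ∈ insert k0 J, k * w k : ℕ) : ℝ)} := by
  have h1 : (q : ℝ) < 1 := by rw [hq, Real.exp_lt_one_iff]; linarith
  have hk0' : (0 : ℝ) < k0 := by exact_mod_cast hk0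
  induction J using Finset.induction_on with
  | empty =>
    intro _ _ y hy
    simp at hy
    have e : {w : ℕ → ℕ | y ≤ ((∑ k ∈ insert k0 (∅ : Finset ℕ), k * w k : ℕ) : ℝ)} =
        {w | ⌈y / k0⌉₊ ≤ w k0} := by
      ext w
      simp only [Set.mem_ofPred_eq, Nat.ceil_le, div_le_iff₀ hk0']
      simp [mul_comm]
    rw [e, BM_tail h1 hk0, hq, ← Real.exp_nat_mul]
    simp only [Finset.prod_empty, mul_one, Real.exp_le_exp]
    have := (Nat.ceil_lt_add_one (a := y / k0) (by positivity)).le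
    have h2 : (k0 : ℝ) * ⌈y / k0⌉₊ ≤ y + k0 := by
      calc (k0 : ℝ) * ⌈y / k0⌉₊ ≤ k0 * (y / k0 + 1) := by gcongr
        _ = y + k0 := by field_simp
    push_cast
    nlinarith
  | insert k J hk ih =>
    intro hpos hnot y hy
    rw [Finset.sum_insert hk] at hy
    have hkp : 0 < k := hpos k (by simp)
    have hkk0 : k ≠ k0 := by rintro rfl; simp at hnot
    have hk0J : k0 ∉ J := fun h => hnot (by simp [h])
    have ih' := ih (fun k hk => hpos k (by simp [hk])) hk0J
    have hsub : (⋃ a ∈ Finset.range (H k + 1), ({w : ℕ → ℕ | w k = a} ∩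
        {w | y - k * a ≤ ((∑ k ∈ insert k0 J, k * w k : ℕ) : ℝ)})) ⊆
        {w | y ≤ ((∑ k ∈ insert k0 (insert k J), k * w k : ℕ) : ℝ)} := by
      intro w hw
      simp only [Set.mem_iUnion, Set.mem_inter_iff, Set.mem_ofPred_eq] at hw ⊢
      obtain ⟨a, _, ha, h⟩ := hw
      rw [Finset.insert_comm, Finset.sum_insert (by simp [hk, hkk0])]
      push_cast at h ⊢
      rw [ha]; linarith
    refine le_trans ?_ (measureReal_mono hsub (measure_ne_top _ _))
    rw [measureReal_biUnion_finset]
    · calc _ = ∑ a ∈ Finset.range (H k + 1), ((1 - (q : ℝ) ^ k) * (q : ℝ) ^ (k * a)) *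
            (Real.exp (-(u * (y - k * a + k0))) *
              ∏ k ∈ J, (((H k : ℝ) + 1) * (1 - (q : ℝ) ^ k))) := by
            rw [Finset.prod_insert hk]
            have : ∀ a ∈ Finset.range (H k + 1), ((1 - (q : ℝ) ^ k) * (q : ℝ) ^ (k * a)) *
              (Real.exp (-(u * (y - k * a + k0))) *
              ∏ k ∈ J, (((H k : ℝ) + 1) * (1 - (q : ℝ) ^ k))) =
               (1 - (q : ℝ) ^ k) * (Real.exp (-(u * (y + k0))) *
                ∏ k ∈ J, (((H k : ℝ) + 1) * (1 - (q : ℝ) ^ k))) := by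
              intro a _
              have e : (q : ℝ) ^ (k * a) * Real.exp (-(u * (y - k * a + k0))) =
                  Real.exp (-(u * (y + k0))) := by
                rw [hq, ← Real.exp_nat_mul, ← Real.exp_add]; congr 1; push_cast; ring
              rw [← e]; ring
            rw [Finset.sum_congr rfl this]
            simp
            ring
        _ ≤ _ := by
            refine Finset.sum_le_sum fun a ha => ?_
            rw [DepOn.indep q (depOn_single k (fun x => x = a))
              (depOn_sum (insert k0 J) (fun x => y - k * a ≤ (x : ℝ))) (by simp [hk, hkk0]),
              BM_sing h1 hkp]
            apply mul_le_mul_of_nonneg_left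
            · apply ih'
              have : (a : ℝ) ≤ H k := by
                have := Finset.mem_range.1 ha
                exact_mod_cast Nat.lt_succ_iff.1 this
              have hk' : (0 : ℝ) ≤ k := by positivity
              nlinarith
            · have := pow_le_one₀ (n := k) q.2.1 h1.le
              have h4 := pow_nonneg q.2.1 (k * a)
              apply mul_nonneg _ h4
              linarith
    · intro a _ b _ hab
      simp only [Function.onFun]
      rw [Set.disjoint_left]
      rintro w ⟨ha, _⟩ ⟨hb, _⟩
      exact hab (ha.symm.trans hb)
    · intro a _
      exact (depOn_single k (fun x => x = a)).meas.inter
        (depOn_sum (insert k0 J) (fun x => y - k * a ≤ (x : ℝ))).meas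

lemma group_indep (q : unitInterval) (J : ℕ → Finset ℕ) (A : ℕ → Set (ℕ → ℕ))
    (hA : ∀ m, DepOn (J m) (A m)) (s : Finset ℕ)  :
    (∀ m ∈ s, ∀ m' ∈ s, m ≠ m' → Disjoint (J m) (J m')) →
    (BM q).real {w | ∀ m ∈ s, w ∈ A m} = ∏ m ∈ s, (BM q).real (A m) := by
  induction s using Finset.induction_on with
  | empty => intro _; simp
  | insert m s hm ih =>
    intro hd
    rw [Finset.prod_insert hm, ← ih (fun a ha b hb => hd a (by simp [ha]) b (by simp [hb]))]
    have e : {w | ∀ m' ∈ insert m s, w ∈ A m'} = A m ∩ {w | ∀ m ∈ s, w ∈ A m} := by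
      ext w; simp
    rw [e]
    apply DepOn.indep q (hA m) (T := s.biUnion J)
    · intro w w' h hw m' hm'
      exact hA m' w w' (fun k hk => h k (Finset.mem_biUnion.2 ⟨m', hm', hk⟩)) (hw m' hm')
    · rw [Finset.disjoint_biUnion_right]
      intro m' hm'
      exact hd m (by simp) m' (by simp [hm']) (by rintro rfl; exact hm hm')

/-- The dyadic class of `m`. -/
def cls (r m : ℕ) : Finset ℕ := (Finset.range (r + 1)).image (fun j => m * 2 ^ j)

lemma cls_eq (r m : ℕ) : cls r m = insert m ((Finset.Icc 1 r).image (fun j => m * 2 ^ j)) := by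
  ext x
  simp only [cls, Finset.mem_image, Finset.mem_range, Finset.mem_insert, Finset.mem_Icc]
  constructor
  · rintro ⟨j, hj, rfl⟩
    rcases Nat.eq_zero_or_pos j with h | h
    · left; simp [h]
    · right; exact ⟨j, by omega, rfl⟩
  · rintro (rfl | ⟨j, hj, rfl⟩)
    · exact ⟨0, by omega, by simp⟩
    · exact ⟨j, by omega, rfl⟩

lemma cls_disj {r M m m' : ℕ} (hm : M ≤ m) (hm2 : m < 2 * M) (hm' : M ≤ m') (hm2' : m' < 2 * M)
    (hne : m ≠ m') : Disjoint (cls r m) (cls r m') := by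
  have key : ∀ a b i j : ℕ, M ≤ a → a < 2 * M → M ≤ b → b < 2 * M → i < j →
      a * 2 ^ i ≠ b * 2 ^ j := by
    intro a b i j _ ha2 hb _ hij h
    obtain ⟨d, rfl⟩ : ∃ d, j = i + 1 + d := ⟨j - i - 1, by omega⟩
    have : a * 2 ^ i = (b * 2 * 2 ^ d) * 2 ^ i := by rw [h]; ring
    have h2 := Nat.eq_of_mul_eq_mul_right (by positivity) this
    have : 1 ≤ 2 ^ d := Nat.one_le_two_pow
    nlinarith
  rw [Finset.disjoint_left]
  intro x hx hx'
  simp only [cls, Finset.mem_image] at hx hx'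
  obtain ⟨i, _, rfl⟩ := hx
  obtain ⟨j, _, h⟩ := hx'
  rcases lt_trichotomy i j with hij | hij | hij
  · exact key m m' i j hm hm2 hm' hm2' hij h.symm
  · subst hij
    exact hne (Nat.eq_of_mul_eq_mul_right (by positivity) h.symm)
  · exact key m' m j i hm' hm2' hm hm2 hij h

lemma geo_factor {u : ℝ} (hu : 0 < u) {k : ℕ} (hk : 0 < k) (h : u * k ≤ 1 / 6) :
    (11 / 2 : ℝ) ≤ ((⌊6 / (u * k)⌋₊ : ℝ) + 1) * (1 - Real.exp (-u) ^ k) := by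
  rw [← Real.exp_nat_mul]
  have hk' : (0 : ℝ) < k := by exact_mod_cast hk
  set x : ℝ := u * k with hx
  have hxp : 0 < x := by positivity
  have e : (k : ℝ) * -u = -x := by rw [hx]; ring
  rw [e]
  have h1 := (Nat.lt_floor_add_one (6 / x)).le
  have h2 := Real.quadratic_le_exp_of_nonneg hxp.le
  have h3 : Real.exp (-x) ≤ 1 - x + x ^ 2 / 2 := by
    rw [Real.exp_neg]
    apply inv_le_of_inv_le₀ (by nlinarith)
    refine le_trans ?_ h2
    rw [inv_le_iff_one_le_mul₀ (by nlinarith)]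
    nlinarith [sq_nonneg (x ^ 2)]
  have h4 : x * (11 / 12) ≤ 1 - Real.exp (-x) := by nlinarith
  calc (11 / 2 : ℝ) = (6 / x) * (x * (11 / 12)) := by field_simp; norm_num
    _ ≤ _ := by gcongr

lemma class_good {q : unitInterval} {u : ℝ} (hu : 0 < u) (hq : (q : ℝ) = Real.exp (-u))
    {m r : ℕ} (hm : 0 < m) (hmr : u * (m * 2 ^ r) ≤ 1 / 6) {y : ℝ} (hy : 6 * r ≤ u * y) :
    Real.exp (-(u * y) - 1 / 6) * (11 / 2) ^ r ≤
      (BM q).real {w | y ≤ ((∑ k ∈ cls r m, k * w k : ℕ) : ℝ)} := by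
  set J := (Finset.Icc 1 r).image (fun j => m * 2 ^ j) with hJ
  have hcard : J.card = r := by
    rw [hJ, Finset.card_image_of_injective]
    · simp
    · intro a b h
      have := Nat.eq_of_mul_eq_mul_left hm h
      exact Nat.pow_right_injective (le_refl 2) this
  have hmem : ∀ k ∈ J, m < k ∧ k ≤ m * 2 ^ r := by
    intro k hk
    obtain ⟨j, hj, rfl⟩ := Finset.mem_image.1 hk
    simp at hj
    constructor
    · have : 2 ≤ 2 ^ j := by simpa using Nat.pow_le_pow_right (n := 2) (by norm_num) hj.1
      nlinarith
    · exact Nat.mul_le_mul_left _ (Nat.pow_le_pow_right (by norm_num) hj.2)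
  have huk : ∀ k : ℕ, k ≤ m * 2 ^ r → u * k ≤ 1 / 6 := by
    intro k hk
    have : (k : ℝ) ≤ m * 2 ^ r := by exact_mod_cast hk
    exact le_trans (mul_le_mul_of_nonneg_left this hu.le) hmr
  have ht := class_tail hu hq hm (fun k => ⌊6 / (u * k)⌋₊) J (fun k hk => by
    have := hmem k hk; omega) (fun h => by have := hmem m h; omega) y (by
      calc _ ≤ ∑ k ∈ J, 6 / u := by
            refine Finset.sum_le_sum fun k hk => ?_
            have hkp : (0 : ℝ) < k := by
              have := hmem k hk
              exact_mod_cast (by omega : 0 < k)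
            have := Nat.floor_le (show 0 ≤ 6 / (u * k) by positivity)
            calc (k : ℝ) * ⌊6 / (u * k)⌋₊ ≤ k * (6 / (u * k)) := by gcongr
              _ = 6 / u := by field_simp
        _ = (6 * r) / u := by rw [Finset.sum_const, hcard, nsmul_eq_mul]; ring
        _ ≤ y := by rw [div_le_iff₀ hu]; linarith)
  rw [← cls_eq] at ht
  refine le_trans ?_ ht
  have hmm := huk m (Nat.le_mul_of_pos_right _ (by positivity))
  apply mul_le_mul
  · rw [Real.exp_le_exp]; linarith
  · rw [← hcard, ← Finset.prod_const]
    refine Finset.prod_le_prod (fun _ _ => by norm_num) fun k hk => ?_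
    rw [hq]
    have := hmem k hk
    exact geo_factor hu (by omega) (huk k this.2)
  · positivity
  · positivity

lemma bad_bd {q : unitInterval} {u : ℝ} (hu : 0 < u) (hq : (q : ℝ) = Real.exp (-u))
    {M M' r : ℕ} (hM : 0 < M) (hMM : M' ≤ M)
    (hmr : ∀ m ∈ Finset.Ico M (M + M'), u * (m * 2 ^ r) ≤ 1 / 6) {y : ℝ} (hy : 6 * r ≤ u * y) :
    (BM q).real {w | ∀ m ∈ Finset.Ico M (M + M'), ((∑ k ∈ cls r m, k * w k : ℕ) : ℝ) < y} ≤
      Real.exp (-(M' * (Real.exp (-(u * y) - 1 / 6) * (11 / 2) ^ r))) := by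
  have := group_indep q (cls r) (fun m => {w | ((∑ k ∈ cls r m, k * w k : ℕ) : ℝ) < y})
    (fun m => depOn_sum (cls r m) (fun x => (x : ℝ) < y)) (Finset.Ico M (M + M')) (by
      intro m hm m' hm' hne
      simp at hm hm'
      exact cls_disj (M := M) hm.1 (by omega) hm'.1 (by omega) hne)
  simp only [Set.mem_ofPred_eq] at this
  rw [this]
  set p := Real.exp (-(u * y) - 1 / 6) * (11 / 2) ^ r
  calc _ ≤ ∏ m ∈ Finset.Ico M (M + M'), Real.exp (-p) := by
        refine Finset.prod_le_prod (fun _ _ => measureReal_nonneg) fun m hm => ?_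
        have hg := class_good hu hq (show 0 < m by simp at hm; omega) (hmr m hm) hy
        have e : {w : ℕ → ℕ | ((∑ k ∈ cls r m, k * w k : ℕ) : ℝ) < y} =
            {w | y ≤ ((∑ k ∈ cls r m, k * w k : ℕ) : ℝ)}ᶜ := by
          ext w; simp only [Set.mem_ofPred_eq, Set.mem_compl_iff, not_le]
        rw [e, probReal_compl_eq_one_sub (depOn_sum (cls r m) (fun x => y ≤ (x : ℝ))).meas]
        have := Real.add_one_le_exp (-p)
        linarith
    _ = _ := by
        rw [Finset.prod_const, ← Real.exp_nat_mul]
        simp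


lemma exists_reduced (N : ℕ) : ∀ s : Multiset ℕ, s.card = N → (∀ x ∈ s, 0 < x) →
    ∃ ν, Relation.ReflTransGen (MergeStep 2) s ν ∧ Reduced 2 ν := by
  induction N using Nat.strong_induction_on with
  | _ N ih =>
    intro s hc hs
    by_cases hr : Reduced 2 s
    · exact ⟨s, Relation.ReflTransGen.refl, hr⟩
    · unfold Reduced at hr
      push Not at hr
      obtain ⟨m, hm⟩ := hr
      have hle : Multiset.replicate 2 m ≤ s := Multiset.le_count_iff_replicate_le.1 (by omega)
      have hm0 : 0 < m := hs m (Multiset.count_pos.1 (by omega))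
      have hcard := Multiset.card_le_card hle
      have h2 : (s - Multiset.replicate 2 m).card = s.card - 2 := by
        rw [Multiset.card_sub hle]; simp
      obtain ⟨ν, h1, h3⟩ := ih (((s - Multiset.replicate 2 m) + {2 * m}).card)
        (by rw [Multiset.card_add, h2]; simp at hcard ⊢; omega)
        ((s - Multiset.replicate 2 m) + {2 * m}) rfl (by
          intro x hx
          rw [Multiset.mem_add] at hx
          rcases hx with hx | hx
          · exact hs x (Multiset.mem_of_le (Multiset.sub_le_self _ _) hx)
          · rw [Multiset.mem_singleton] at hx; omega)
      exact ⟨ν, Relation.ReflTransGen.head ⟨m, hm0, hle, rfl⟩ h1, h3⟩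

open Classical in
noncomputable def fcl (m x : ℕ) : ℕ := if ∃ j, x = m * 2 ^ j then x else 0

lemma fcl_two (m a : ℕ) : 2 * fcl m a ≤ fcl m (2 * a) := by
  unfold fcl
  by_cases h : ∃ j, a = m * 2 ^ j
  · have : ∃ j, 2 * a = m * 2 ^ j := by
      obtain ⟨j, hj⟩ := h
      exact ⟨j + 1, by rw [hj]; ring⟩
    rw [if_pos h, if_pos this]
  · rw [if_neg h]; simp

noncomputable def CS (m : ℕ) (s : Multiset ℕ) : ℕ := (s.map (fcl m)).sum

lemma CS_step (m : ℕ) {s t : Multiset ℕ} (h : MergeStep 2 s t) : CS m s ≤ CS m t := by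
  obtain ⟨a, _, hle, rfl⟩ := h
  have := tsub_add_cancel_of_le hle
  conv_lhs => rw [← this]
  unfold CS
  simp only [Multiset.map_add, Multiset.sum_add, Multiset.map_replicate, Multiset.sum_replicate,
    Multiset.map_singleton, Multiset.sum_singleton, smul_eq_mul]
  have := fcl_two m a
  omega

lemma CS_rtg (m : ℕ) {s t : Multiset ℕ} (h : Relation.ReflTransGen (MergeStep 2) s t) :
    CS m s ≤ CS m t := by
  induction h with
  | refl => exact le_rfl
  | tail _ h ih => exact ih.trans (CS_step m h)

lemma CS_large {m i : ℕ} (hm : 0 < m) {ν : Multiset ℕ} (hr : Reduced 2 ν)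
    (h : m * 2 ^ i ≤ CS m ν) : ∃ a ∈ ν, m * 2 ^ i ≤ a := by
  by_contra hcon
  push Not at hcon
  have hle : CS m ν ≤ ∑ x ∈ (Finset.range i).image (fun j => m * 2 ^ j), x := by
    unfold CS
    rw [Finset.sum_multiset_map_count]
    calc _ ≤ ∑ x ∈ ν.toFinset, fcl m x := by
          apply Finset.sum_le_sum
          intro x _
          have := hr x
          simp only [smul_eq_mul]
          calc _ ≤ 1 * fcl m x := Nat.mul_le_mul_right _ (by simpa using this)
            _ = _ := one_mul _
      _ ≤ ∑ x ∈ (Finset.range i).image (fun j => m * 2 ^ j), fcl m x := by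
          apply Finset.sum_le_sum_of_ne_zero
          intro x hx hne
          unfold fcl at hne
          have : ∃ j, x = m * 2 ^ j := by
            by_contra hc
            rw [if_neg hc] at hne
            exact hne rfl
          obtain ⟨j, rfl⟩ := this
          have := hcon _ (Multiset.mem_toFinset.1 hx)
          have h2 := lt_of_mul_lt_mul_left this (Nat.zero_le _)
          exact Finset.mem_image.2 ⟨j, Finset.mem_range.2
            ((Nat.pow_lt_pow_iff_right (by norm_num)).1 h2), rfl⟩
      _ ≤ _ := by
          apply Finset.sum_le_sum
          intro x _
          unfold fcl
          split_ifs <;> omega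
  have h2 : ∑ x ∈ (Finset.range i).image (fun j => m * 2 ^ j), x ≤
      ∑ j ∈ Finset.range i, m * 2 ^ j := by
    rw [Finset.sum_image]
    intro a _ b _ hab
    exact Nat.pow_right_injective (le_refl 2) (Nat.eq_of_mul_eq_mul_left hm hab)
  have h3 : ∑ j ∈ Finset.range i, m * 2 ^ j = m * (2 ^ i - 1) := by
    rw [← Finset.mul_sum]
    congr 1
    exact Nat.geomSum_eq (le_refl 2) i |>.trans (by simp)
  have h4 : m * (2 ^ i - 1) < m * 2 ^ i :=
    Nat.mul_lt_mul_of_pos_left (Nat.sub_lt (by positivity) one_pos) hm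
  omega

lemma cls_le_CS (r m : ℕ) (s : Multiset ℕ) : ∑ k ∈ cls r m, k * s.count k ≤ CS m s := by
  unfold CS
  rw [Finset.sum_multiset_map_count]
  calc _ ≤ ∑ k ∈ cls r m, s.count k • fcl m k := by
        apply Finset.sum_le_sum
        intro k hk
        obtain ⟨j, _, hj⟩ := Finset.mem_image.1 hk
        unfold fcl
        rw [if_pos ⟨j, hj.symm⟩, smul_eq_mul, mul_comm]
    _ ≤ _ := by
        apply Finset.sum_le_sum_of_ne_zero
        intro k _ hne
        rw [Multiset.mem_toFinset, ← Multiset.count_pos]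
        by_contra hc
        apply hne
        have : s.count k = 0 := by omega
        rw [this]; simp

def Good (n : ℕ) (T : ℝ) (μ : Nat.Partition n) : Prop :=
  ∃ ν : Multiset ℕ, Relation.ReflTransGen (MergeStep 2) μ.parts ν ∧
              Reduced 2 ν ∧ ∃ a ∈ ν, T ≤ (a : ℝ)

lemma good_of {n : ℕ} {T : ℝ} (μ : Nat.Partition n) {r m i : ℕ} (hm : 0 < m)
    (hT : T ≤ ((m * 2 ^ i : ℕ) : ℝ)) (h : m * 2 ^ i ≤ ∑ k ∈ cls r m, k * μ.parts.count k) :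
    Good n T μ := by
  obtain ⟨ν, h1, h2⟩ := exists_reduced _ μ.parts rfl (fun x hx => μ.parts_pos hx)
  obtain ⟨a, ha, hle⟩ := CS_large hm h2 (h.trans ((cls_le_CS r m _).trans (CS_rtg m h1)))
  exact ⟨ν, h1, h2, a, ha, hT.trans (by exact_mod_cast hle)⟩


open Classical in
lemma bad_count {n : ℕ} {q : unitInterval} {u : ℝ} (hu : 0 < u) (hq : (q:ℝ) = Real.exp (-u))
    {M M' r i : ℕ} (hM : 0 < M) (hMM : M' ≤ M)
    (hmr : ∀ m ∈ Finset.Ico M (M+M'), u*(m*2^r) ≤ 1/6) {y T : ℝ} (hy : 6*r ≤ u*y)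
    (hmn : ∀ m ∈ Finset.Ico M (M+M'), m * 2^r ≤ n)
    (hT : ∀ m ∈ Finset.Ico M (M+M'), T ≤ ((m * 2^i : ℕ) : ℝ))
    (hyi : ∀ m ∈ Finset.Ico M (M+M'), ((m * 2^i : ℕ) : ℝ) ≤ y) :
    ((Finset.univ.filter (fun μ : Nat.Partition n => ¬ Good n T μ)).card : ℝ) *
      ((q:ℝ)^n * WW n q) ≤ Real.exp (-(M' * (Real.exp (-(u*y) - 1/6) * (11/2)^r))) := by
  have h1 : (q:ℝ) < 1 := by rw [hq]; simpa using hu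
  rw [← Cyl_count le_rfl h1]
  refine le_trans ?_ (bad_bd hu hq hM hMM hmr hy)
  apply measureReal_mono _ (measure_ne_top _ _)
  intro w hw
  simp only [Set.mem_iUnion, Finset.mem_filter, Finset.mem_univ, true_and] at hw
  obtain ⟨μ, hμ, hw⟩ := hw
  intro m hm
  have hm0 : 0 < m := by rw [Finset.mem_Ico] at hm; omega
  refine lt_of_lt_of_le ?_ (hyi m hm)
  by_contra hcon
  apply hμ
  refine good_of (r := r) μ hm0 (hT m hm) ?_
  have h3 : ∑ k ∈ cls r m, k * w k = ∑ k ∈ cls r m, k * μ.parts.count k := by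
    apply Finset.sum_congr rfl
    intro k hk
    rw [hw k]
    obtain ⟨j, hj, rfl⟩ := Finset.mem_image.1 hk
    rw [Finset.mem_Icc]
    refine ⟨Nat.mul_pos hm0 (by positivity), le_trans ?_ (hmn m hm)⟩
    exact Nat.mul_le_mul_left _ (Nat.pow_le_pow_right (by norm_num)
      (by rw [Finset.mem_range] at hj; omega))
  rw [← h3]
  push Not at hcon
  exact_mod_cast hcon

open Classical in
lemma frac_eq (n : ℕ) (T : ℝ) :
    (Nat.card {μ : Nat.Partition n // Good n T μ} : ℝ) / Nat.card (Nat.Partition n) =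
    1 - ((Finset.univ.filter (fun μ : Nat.Partition n => ¬ Good n T μ)).card : ℝ) /
      Fintype.card (Nat.Partition n) := by
  have hp : (0:ℝ) < Fintype.card (Nat.Partition n) := by exact_mod_cast Fintype.card_pos
  rw [Nat.card_eq_fintype_card, Nat.card_eq_fintype_card, Fintype.card_subtype]
  have := Finset.card_filter_add_card_filter_not (s := (Finset.univ : Finset (Nat.Partition n)))
    (fun μ => Good n T μ)
  rw [Finset.card_univ] at this
  rw [eq_sub_iff_add_eq, ← add_div, div_eq_one_iff_eq hp.ne']
  exact_mod_cast this

open Classical in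
lemma ratio_bound {n g : ℕ} {q : unitInterval} {E L : ℝ} {T : ℝ} (h1 : (q:ℝ) < 1)
    (hE : ((Finset.univ.filter (fun μ : Nat.Partition n => ¬ Good n T μ)).card : ℝ) *
      ((q:ℝ)^n * WW n q) ≤ E) (hL : 0 < L)
    (hg : L ≤ (q:ℝ)^g * (QQ n q * (1 - QQ n q - n*(q:ℝ)^g))) :
    ((Finset.univ.filter (fun μ : Nat.Partition n => ¬ Good n T μ)).card : ℝ) /
      Fintype.card (Nat.Partition n) ≤ (n+1) * (n+1) * E / L := by
  have hp : (0:ℝ) < Fintype.card (Nat.Partition n) := by exact_mod_cast Fintype.card_pos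
  have := hg.trans (pn_lb (n := n) (g := g) h1)
  rw [div_le_div_iff₀ hp hL]
  set b := ((Finset.univ.filter (fun μ : Nat.Partition n => ¬ Good n T μ)).card : ℝ)
  have hb : 0 ≤ b := Nat.cast_nonneg _
  calc b * L ≤ b * ((n+1) * ((n+1) * ((Fintype.card (Nat.Partition n):ℝ) * ((q:ℝ)^n * WW n q)))) :=
        mul_le_mul_of_nonneg_left this hb
    _ = (n+1) * (n+1) * (b * ((q:ℝ)^n * WW n q)) * (Fintype.card (Nat.Partition n):ℝ) := by ring
    _ ≤ _ := by gcongr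


lemma u_bounds {n : ℕ} (hx : (400:ℝ) ≤ Real.sqrt n) : ∃ (q : unitInterval) (u : ℝ), 0 < u ∧
    (q:ℝ) = Real.exp (-u) ∧ QQ n q = 1/50 ∧ u * Real.sqrt n ≤ 10/7 ∧ 1/4 ≤ u * Real.sqrt n := by
  set x := Real.sqrt n with hxd
  have hxx : x * x = n := Real.mul_self_sqrt (Nat.cast_nonneg n)
  have hn0 : 0 < n := by
    have : (0:ℝ) < n := by rw [← hxx]; nlinarith
    exact_mod_cast this
  obtain ⟨q, h0, h1, hQ⟩ := exists_q hn0 (θ := 1/50) (by norm_num) (by norm_num)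
  have hu : 0 < -Real.log q := by
    have := Real.log_neg h0 h1
    linarith
  have hq : (q:ℝ) = Real.exp (-(-Real.log q)) := by rw [neg_neg, Real.exp_log h0]
  generalize hud : -Real.log q = u at hu hq
  refine ⟨q, u, hu, hq, hQ, ?_, ?_⟩
  · have h := markov (n := n) hu hq
    rw [hQ, le_div_iff₀ (by positivity), ← hxx] at h
    have : (u * x)^2 ≤ (10/7)^2 := by nlinarith
    exact le_of_sq_le_sq this (by norm_num)
  · by_contra hcon
    push Not at hcon
    set K := ⌈3 * x⌉₊
    have hK1 : 3 * x ≤ K := Nat.le_ceil _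
    have hK2 : (K:ℝ) < 3 * x + 1 := Nat.ceil_lt_add_one (by linarith)
    have hKn : K ≤ n := by
      have : (K:ℝ) ≤ n := by nlinarith
      exact_mod_cast this
    have huK : u * K ≤ 1 := by nlinarith
    have h := lower_u hKn hu hq huK
    rw [hQ] at h
    have h2 : Real.exp (u * n) ≤ Real.exp (x/4) := by
      apply Real.exp_le_exp.2
      rw [← hxx]; nlinarith
    have h3 : Real.exp (3*x/4) ≤ (13/10:ℝ)^K := by
      have h4 : Real.exp (1/4) ≤ 13/10 := by
        have : Real.exp (1/4) ^ 4 ≤ (13/10)^4 := by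
          rw [← Real.exp_nat_mul]
          norm_num
          have := Real.exp_one_lt_d9
          linarith
        exact le_of_pow_le_pow_left₀ (by norm_num) (by norm_num) this
      calc Real.exp (3*x/4) ≤ Real.exp (K * (1/4)) := Real.exp_le_exp.2 (by linarith)
        _ = Real.exp (1/4) ^ K := by rw [Real.exp_nat_mul]
        _ ≤ _ := by gcongr
    have h5 : Real.exp (3*x/4) = Real.exp (x/4) * Real.exp (x/2) := by
      rw [← Real.exp_add]; congr 1; ring
    have h6 := Real.add_one_le_exp (x/2)
    have h7 := Real.exp_pos (x/4)
    nlinarith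

lemma qg_bound {n : ℕ} (hl : (1000000:ℝ) ≤ Real.log n) (hx : (400:ℝ) ≤ Real.sqrt n)
    {q : unitInterval} {u : ℝ} (hu : 0 < u)
    (hq : (q:ℝ) = Real.exp (-u)) (hQ : QQ n q = 1/50) (hu1 : u * Real.sqrt n ≤ 10/7)
    (hu2 : 1/4 ≤ u * Real.sqrt n) :
    ∃ g : ℕ, Real.exp (-12 * Real.log n - 1) / 100 ≤
      (q:ℝ)^g * (QQ n q * (1 - QQ n q - n*(q:ℝ)^g)) := by
  set x := Real.sqrt n with hxd
  set l := Real.log n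
  have hxx : x * x = n := Real.mul_self_sqrt (Nat.cast_nonneg n)
  have hn0 : (0:ℝ) < n := by rw [← hxx]; nlinarith
  refine ⟨⌈8 * x * l⌉₊, ?_⟩
  set g := ⌈8 * x * l⌉₊
  have hg1 : 8 * x * l ≤ g := Nat.le_ceil _
  have hg2 : (g:ℝ) < 8 * x * l + 1 := Nat.ceil_lt_add_one (by positivity)
  have hqg : (q:ℝ)^g = Real.exp (-(u * g)) := by
    rw [hq, ← Real.exp_nat_mul]; congr 1; ring
  have hul : u ≤ 1 := by nlinarith
  have e1 : 2 * l ≤ u * g := by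
    have := mul_le_mul_of_nonneg_left hg1 hu.le
    nlinarith
  have e2 : u * g ≤ 12 * l + 1 := by
    have := mul_le_mul_of_nonneg_left hg2.le hu.le
    nlinarith
  have hnl : Real.exp l = n := Real.exp_log hn0
  have e3 : n * (q:ℝ)^g ≤ 1/50 := by
    rw [hqg, ← hnl, ← Real.exp_add]
    calc _ ≤ Real.exp (-50) := Real.exp_le_exp.2 (by linarith)
      _ ≤ 1/50 := by
        rw [Real.exp_neg, ← one_div]
        apply one_div_le_one_div_of_le (by norm_num)
        have := Real.add_one_le_exp (50:ℝ)
        linarith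
  have e4 : Real.exp (-12 * l - 1) ≤ (q:ℝ)^g := by
    rw [hqg]; exact Real.exp_le_exp.2 (by linarith)
  rw [hQ]
  have := Real.exp_pos (-12 * l - 1)
  nlinarith

noncomputable def TT (n : ℕ) : ℝ :=
  (1 + 1 / 100) * (Real.sqrt 6 / (2 * Real.pi)) * Real.sqrt n * Real.log n

lemma TT_const : 39/100 ≤ (1 + 1 / 100) * (Real.sqrt 6 / (2 * Real.pi)) ∧
    (1 + 1 / 100) * (Real.sqrt 6 / (2 * Real.pi)) ≤ 394/1000 := by
  have h1 := Real.pi_gt_d4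
  have h2 := Real.pi_lt_d4
  have h3 : Real.sqrt 6 ≤ 2.4495 := Real.sqrt_le_iff.2 ⟨by norm_num, by norm_num⟩
  have h4 : 2.449 ≤ Real.sqrt 6 := Real.le_sqrt_of_sq_le (by norm_num)
  have hp := Real.pi_pos
  constructor
  · rw [← mul_div_assoc, le_div_iff₀ (by positivity)]; linarith
  · rw [← mul_div_assoc, div_le_iff₀ (by positivity)]; linarith

set_option maxHeartbeats 2000000 in
open Classical in
lemma main_bound {n : ℕ} (hl : (1000000:ℝ) ≤ Real.log n) :
    ((Finset.univ.filter (fun μ : Nat.Partition n => ¬ Good n (TT n) μ)).card : ℝ) /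
      Fintype.card (Nat.Partition n) ≤
    400 * Real.exp (14 * Real.log n + 1 - Real.exp (Real.log n / 100 - 7/6) / 5000) := by
  have hn0 : (0:ℝ) < n := by
    rcases Nat.eq_zero_or_pos n with h | h
    · rw [h] at hl; simp at hl; linarith
    · exact_mod_cast h
  have hT : TT n = (1 + 1 / 100) * (Real.sqrt 6 / (2 * Real.pi)) * Real.sqrt n * Real.log n := rfl
  set x := Real.sqrt n with hxd
  set l := Real.log n
  have hnl : Real.exp l = n := Real.exp_log hn0
  have hxl : x = Real.exp (l/2) := by
    rw [hxd, ← hnl, Real.exp_half]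
  have hxx : x * x = n := Real.mul_self_sqrt (Nat.cast_nonneg n)
  have hx : (400:ℝ) ≤ x := by
    rw [hxl]; have := Real.add_one_le_exp (l/2); linarith
  obtain ⟨q, u, hu, hq, hQ, hu1, hu2⟩ := u_bounds hx
  obtain ⟨g, hg⟩ := qg_bound hl hx hu hq hQ hu1 hu2
  have h1 : (q:ℝ) < 1 := by rw [hq]; simpa using hu
  have hxl0 : 0 < x * l := by positivity
  have hT1 : 39/100 * (x * l) ≤ TT n := by
    rw [hT, mul_assoc _ x l]; exact mul_le_mul_of_nonneg_right TT_const.1 hxl0.le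
  have hT2 : TT n ≤ 394/1000 * (x * l) := by
    rw [hT, mul_assoc _ x l]; exact mul_le_mul_of_nonneg_right TT_const.2 hxl0.le
  clear hT
  generalize TT n = T at hT1 hT2 ⊢
  -- parameters
  obtain ⟨s, hs1, hs2⟩ : ∃ s : ℕ, 4 * l ≤ (2:ℝ)^s ∧ (2:ℝ)^s ≤ 8 * l := by
    obtain ⟨s, h1, h2⟩ := exists_nat_pow_near (x := 4 * l) (y := 2) (by linarith) (by norm_num)
    refine ⟨s+1, h2.le, ?_⟩
    rw [pow_succ]; linarith
  obtain ⟨r, hr1, hr2⟩ : ∃ r : ℕ, (r:ℝ) ≤ 9/100 * l ∧ 9/100 * l < r + 1 :=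
    ⟨⌊9/100*l⌋₊, Nat.floor_le (by positivity), Nat.lt_floor_add_one _⟩
  set y := 58/100 * l / u with hyd
  have huy : u * y = 58/100 * l := by rw [hyd]; field_simp
  have hy1 : 406/1000 * (x * l) ≤ y := by
    rw [hyd, le_div_iff₀ hu]; nlinarith
  have h2r : (2:ℝ)^r ≤ Real.exp (9/100*l) := by
    calc (2:ℝ)^r ≤ Real.exp 1 ^ r := by
          gcongr
          have := Real.exp_one_gt_d9; linarith
      _ = Real.exp r := by rw [← Real.exp_nat_mul, mul_one]
      _ ≤ _ := Real.exp_le_exp.2 hr1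
  have hx2 : x = Real.exp (41/100*l) * Real.exp (9/100*l) := by
    rw [hxl, ← Real.exp_add]; congr 1; ring
  have h41 : 410000 ≤ Real.exp (41/100*l) := by
    have := Real.add_one_le_exp (41/100*l); linarith
  have h2i : (2:ℝ)^(r+s) * 1000 ≤ T := by
    rw [pow_add]
    have hp : (2:ℝ)^r * 2^s ≤ Real.exp (9/100*l) * (8*l) := by gcongr
    have hE := Real.exp_pos (9/100*l)
    have : 410000 * (Real.exp (9/100*l) * l) ≤ x * l := by
      rw [hx2]
      have : 0 ≤ Real.exp (9/100*l) * l := by positivity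
      nlinarith
    linarith
  set P := (2:ℝ)^(r+s) with hP
  have hP0 : 0 < P := by positivity
  have hPP : P = 2^r * 2^s := pow_add _ _ _
  set M := ⌈T / P⌉₊ with hM
  have hTP : 1000 ≤ T / P := by rw [le_div_iff₀ hP0]; linarith
  have hM1 : T / P ≤ M := Nat.le_ceil _
  have hM2 : (M:ℝ) < T / P + 1 := Nat.ceil_lt_add_one (by linarith)
  have hTM : T ≤ M * P := by rwa [div_le_iff₀ hP0] at hM1
  have hTM2 : M * P ≤ T + P := by
    have : (M:ℝ) * P ≤ (T / P + 1) * P := mul_le_mul_of_nonneg_right hM2.le hP0.le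
    rw [add_mul, div_mul_cancel₀ _ hP0.ne'] at this
    linarith
  have hM0 : 0 < M := by
    have : (0:ℝ) < M := by linarith
    exact_mod_cast this
  set M' := M / 100 with hM'
  have hM'1 : (M':ℝ) ≤ M / 100 := by
    have : 100 * M' ≤ M := Nat.mul_div_le _ _
    have : (100:ℝ) * M' ≤ M := by exact_mod_cast this
    linarith
  have hM'2 : (M:ℝ) / 100 - 1 ≤ M' := by
    have : M ≤ 100 * M' + 100 := by omega
    have : (M:ℝ) ≤ 100 * M' + 100 := by exact_mod_cast this
    linarith
  have hmy : ∀ m ∈ Finset.Ico M (M+M'), (m:ℝ) * P ≤ y := by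
    intro m hm
    have hm2 : (m:ℝ) ≤ M + M' := by
      have := (Finset.mem_Ico.1 hm).2.le
      exact_mod_cast this
    have : (m:ℝ) * P ≤ (101/100 * M) * P := mul_le_mul_of_nonneg_right (by linarith) hP0.le
    linarith
  have hmr : ∀ m ∈ Finset.Ico M (M+M'), u*(m*2^r) ≤ 1/6 := by
    intro m hm
    have h := mul_le_mul_of_nonneg_left (hmy m hm) hu.le
    rw [huy, hPP] at h
    have hz : 0 ≤ u * (m*2^r) := by positivity
    have h3 := mul_le_mul_of_nonneg_left hs1 hz
    have h4 : u * (m*2^r) * 2^s = u * (m * (2^r*2^s)) := by ring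
    rw [h4] at h3
    generalize u * (m*2^r) = z at h3 hz ⊢
    have h5 : z * (4 * l) ≤ 1/6 * (4 * l) := by linarith
    exact le_of_mul_le_mul_right h5 (by linarith)
  have hE := bad_count (n := n) (T := T) (i := r + s) hu hq hM0 (by omega : M' ≤ M) hmr (y := y)
    (by rw [huy]; linarith)
    (by
      intro m hm
      have h := hmr m hm
      have : ((m * 2^r : ℕ):ℝ) ≤ n := by
        push_cast
        rw [← hxx]
        have hz : (0:ℝ) ≤ m*2^r := by positivity
        have h5 : (m*2^r:ℝ) * (1/4) ≤ (m*2^r) * (u * x) := mul_le_mul_of_nonneg_left hu2 hz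
        nlinarith
      exact_mod_cast this)
    (by
      intro m hm
      have : (M:ℝ) ≤ m := by exact_mod_cast (Finset.mem_Ico.1 hm).1
      push_cast
      exact hTM.trans (mul_le_mul_of_nonneg_right this hP0.le))
    (by
      intro m hm
      push_cast
      exact hmy m hm)
  have hL : 0 < Real.exp (-12 * l - 1) / 100 := by positivity
  have hR := ratio_bound h1 hE hL hg
  refine hR.trans ?_
  -- exponent
  have hA : Real.exp (l/100 - 7/6) / 5000 ≤ M' * (Real.exp (-(u*y) - 1/6) * (11/2)^r) := by
    have hM'3 : T / P / 200 ≤ M' := by linarith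
    have hM'4 : x / (5000 * 2^r) ≤ M' := by
      refine le_trans ?_ hM'3
      rw [div_div, div_le_div_iff₀ (by positivity) (by positivity), hPP]
      have h7 : x * (2^r * 2^s * 200) ≤ x * (2^r * (8*l) * 200) := by gcongr
      have h8 : 39/100 * (x * l) * (5000 * 2^r) ≤ T * (5000 * 2^r) := by gcongr
      have h9 : 0 ≤ x * l * 2^r := by positivity
      nlinarith
    have h275 : Real.exp (9/100*l - 1) * 2^r ≤ (11/2:ℝ)^r := by
      have : (11/2:ℝ)^r = (11/4)^r * 2^r := by rw [← mul_pow]; norm_num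
      rw [this]
      gcongr
      calc Real.exp (9/100*l-1) ≤ Real.exp r := Real.exp_le_exp.2 (by linarith)
        _ = Real.exp 1 ^ r := by rw [← Real.exp_nat_mul, mul_one]
        _ ≤ _ := by
          gcongr
          have := Real.exp_one_lt_d9; linarith
    calc Real.exp (l/100 - 7/6) / 5000
        = x / (5000 * 2^r) * (Real.exp (-(u*y) - 1/6) * (Real.exp (9/100*l - 1) * 2^r)) := by
          have : Real.exp (l/100 - 7/6) =
            x * Real.exp (-(u*y) - 1/6) * Real.exp (9/100*l - 1) := by
            rw [hxl, huy, ← Real.exp_add, ← Real.exp_add]; congr 1; ring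
          rw [this]; field_simp
      _ ≤ _ := by gcongr
  have hn1 : (1:ℝ) ≤ n := by rw [← hxx]; nlinarith
  rw [div_le_iff₀ hL]
  have hfin : 400 * Real.exp (14 * l + 1 - Real.exp (l / 100 - 7 / 6) / 5000) *
      (Real.exp (-12 * l - 1) / 100) = 4 * (n * n) *
        Real.exp (-(Real.exp (l / 100 - 7 / 6) / 5000)) := by
    rw [← hnl]
    have : Real.exp (14 * l + 1 - Real.exp (l / 100 - 7 / 6) / 5000) * Real.exp (-12 * l - 1)
      = Real.exp l * Real.exp l * Real.exp (-(Real.exp (l / 100 - 7 / 6) / 5000)) := by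
      rw [← Real.exp_add, ← Real.exp_add, ← Real.exp_add]; congr 1; ring
    linear_combination 4 * this
  rw [hfin]
  have : ((n:ℝ)+1)*(n+1) ≤ 4 * (n*n) := by nlinarith
  have h10 := Real.exp_le_exp.2 (neg_le_neg hA)
  gcongr

lemma bound_tendsto : Filter.Tendsto (fun n : ℕ =>
    400 * Real.exp (14 * Real.log n + 1 - Real.exp (Real.log n / 100 - 7/6) / 5000))
    Filter.atTop (nhds 0) := by
  have h1 : Filter.Tendsto (fun n : ℕ => Real.log n) Filter.atTop Filter.atTop :=
    Real.tendsto_log_atTop.comp tendsto_natCast_atTop_atTop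
  have h2 : Filter.Tendsto (fun l : ℝ => 14 * l + 1 - Real.exp (l / 100 - 7/6) / 5000)
      Filter.atTop Filter.atBot := by
    apply Filter.tendsto_atBot_mono' _ _ Filter.tendsto_neg_atTop_atBot
    filter_upwards [Filter.eventually_ge_atTop (10^14:ℝ)] with l hl
    have h3 := Real.quadratic_le_exp_of_nonneg (x := l/100 - 7/6) (by linarith)
    nlinarith
  have h3 := (Real.tendsto_exp_atBot.comp (h2.comp h1)).const_mul 400
  simpa [Function.comp_def] using h3

theorem reduction_has_large_part' :
    Filter.Tendsto
      (fun n : ℕ =>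
        (Nat.card {μ : Nat.Partition n //
            ∃ ν : Multiset ℕ, Relation.ReflTransGen (MergeStep 2) μ.parts ν ∧
              Reduced 2 ν ∧
              ∃ a ∈ ν, (1 + 1 / 100) * (Real.sqrt 6 / (2 * Real.pi)) *
                  Real.sqrt n * Real.log n ≤ (a : ℝ)} : ℝ) /
          Nat.card (Nat.Partition n))
      Filter.atTop (nhds 1) := by
  classical
  change Filter.Tendsto (fun n : ℕ => (Nat.card {μ : Nat.Partition n // Good n (TT n) μ} : ℝ) /
    Nat.card (Nat.Partition n)) Filter.atTop (nhds 1)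
  simp_rw [frac_eq]
  have h1 : Filter.Tendsto (fun n : ℕ => Real.log n) Filter.atTop Filter.atTop :=
    Real.tendsto_log_atTop.comp tendsto_natCast_atTop_atTop
  have h := squeeze_zero' (t₀ := Filter.atTop) (f := fun n : ℕ =>
    ((Finset.univ.filter (fun μ : Nat.Partition n => ¬ Good n (TT n) μ)).card : ℝ) /
      Fintype.card (Nat.Partition n)) (Filter.Eventually.of_forall fun n => by positivity)
    ((h1.eventually_ge_atTop 1000000).mono fun n hn => by
      convert main_bound hn) bound_tendsto
  convert h.const_sub 1 using 2
  norm_num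


end

/-- For `p = 2`, for all but an `o(1)`-proportion of partitions `μ` of `n`, the reduced
partition `μ̃` (into distinct parts, obtained by repeatedly merging equal pairs) has a part
of size at least `(1 + 1/100)·(√6/(2π))·√n·log n`. -/
theorem reduction_has_large_part :
    Tendsto
      (fun n : ℕ =>
        (Nat.card {μ : Nat.Partition n //
            ∃ ν : Multiset ℕ, Relation.ReflTransGen (MergeStep 2) μ.parts ν ∧
              Reduced 2 ν ∧
              ∃ a ∈ ν, (1 + 1 / 100) * (Real.sqrt 6 / (2 * π)) *
                  Real.sqrt n * Real.log n ≤ (a : ℝ)} : ℝ) /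
          Nat.card (Nat.Partition n))
      atTop (nhds 1) := by
  exact reduction_has_large_part'
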